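/- Let ε ∈ (0,1) and c > 0 be real numbers, let S be a finite set, and let λ : S → ℝ take strictly positive values. If Σ_{k ∈ S} λ_k^{−1/2} (e^{−λ_k ε²} − e^{−100 λ_k ε²}) ≥ c √ε, then the cardinality of S satisfies #S ≥ (c/100) · ε^{−1/2}. -/

import Mathlib

theorem exp_neg_sq_sub_exp_neg_hundred_sq_le {x : ℝ} (hx : 0 ≤ x) :
    Real.exp (-x ^ 2) - Real.exp (-(100 * x ^ 2)) ≤ 100 * x := by
  have h₁ : Real.exp (-x ^ 2) ≤ 1 := Real.exp_le_one_iff.2 (by nlinarith)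
  have h₂ := Real.add_one_le_exp (-(100 * x ^ 2))
  have h₃ := Real.exp_pos (-(100 * x ^ 2))
  rcases le_total x 1 with h | h <;> nlinarith

theorem Real.rpow_neg_one_div_two (x : ℝ) (hx : 0 ≤ x) : x ^ (-(1 : ℝ) / 2) = (√x)⁻¹ := by
  rw [neg_div, Real.rpow_neg hx, Real.sqrt_eq_rpow]

/-- if `Σ_{k ∈ S} λ_k^{-1/2} (e^{-λ_kε²} - e^{-100λ_kε²}) ≥ c√ε`, then
`#S ≥ (c/100) ε^{-1/2}`. -/
theorem stmt_13 {ι : Type*} (S : Finset ι) (lam : ι → ℝ) (hlam : ∀ k ∈ S, 0 < lam k)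
    (ε c : ℝ) (hε : ε ∈ Set.Ioo (0 : ℝ) 1) (hc : 0 < c)
    (h : c * Real.sqrt ε ≤ ∑ k ∈ S, lam k ^ (-(1 : ℝ) / 2) *
      (Real.exp (-(lam k * ε ^ 2)) - Real.exp (-(100 * lam k * ε ^ 2)))) :
    (c / 100) * ε ^ (-(1 : ℝ) / 2) ≤ (S.card : ℝ) := by
  have hε₀ : 0 < ε := hε.1
  have hterm : ∀ k ∈ S, lam k ^ (-(1 : ℝ) / 2) *
      (Real.exp (-(lam k * ε ^ 2)) - Real.exp (-(100 * lam k * ε ^ 2))) ≤ 100 * ε := by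
    intro k hk
    have hsqrt : 0 < √(lam k) := Real.sqrt_pos.2 (hlam k hk)
    have hsq : (√(lam k) * ε) ^ 2 = lam k * ε ^ 2 := by
      rw [mul_pow, Real.sq_sqrt (hlam k hk).le]
    have hbound := exp_neg_sq_sub_exp_neg_hundred_sq_le (mul_pos hsqrt hε₀).le
    rw [hsq, ← mul_assoc] at hbound
    rw [Real.rpow_neg_one_div_two _ (hlam k hk).le, inv_mul_le_iff₀ hsqrt]
    linarith
  have hsum := h.trans (Finset.sum_le_card_nsmul S _ _ hterm)
  rw [nsmul_eq_mul] at hsum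
  have hsqrt : 0 < √ε := Real.sqrt_pos.2 hε₀
  rw [Real.rpow_neg_one_div_two _ hε₀.le, ← div_eq_mul_inv, div_le_iff₀ hsqrt]
  refine le_of_mul_le_mul_right ?_ hsqrt
  rw [mul_assoc (S.card : ℝ), Real.mul_self_sqrt hε₀.le]
  linarith
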